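/- Let 0 ≤ r₁ ≤ 1 and let q ∈ ℝ² be a point with ‖q‖₂ = r₁. For every finite set S contained in the ring {x ∈ ℝ² : r₁ ≤ ‖x‖₂ ≤ 1}, there exist a partition of S into two (possibly empty) sets S₁ and S₂ and wake-up trees for S₁ and for S₂, each rooted at q with edge lengths measured by the Euclidean norm on ℝ², such that each of the two wake-up trees has makespan at most π + 3 − 3r₁. -/

import Mathlib

/-- `IsWakeUpTree d p₀ S parent t` : `parent` encodes a rooted spanning tree on the node
node set `{p₀} ∪ S` (each non-root node has a parent among the nodes and reaches the root
by iterating `parent`), the root `p₀` has exactly one child (when there is a non-root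
node), every non-root node has at most two children, and `t v` is the sum of the
`d`-distances along the tree path from `p₀` to `v` (so the makespan of the tree is the
maximum of `t` over the nodes). -/
def IsWakeUpTree {X : Type*} (d : X → X → ℝ) (p₀ : X) (S : Finset X)
    (parent : X → X) (t : X → ℝ) : Prop :=
  t p₀ = 0 ∧
  (∀ p ∈ S, p ≠ p₀ →
      (parent p = p₀ ∨ parent p ∈ S) ∧
      t p = t (parent p) + d (parent p) p ∧
      ∃ n : ℕ, parent^[n] p = p₀) ∧
  -- the root has at most one child
  (∀ x ∈ S, x ≠ p₀ → parent x = p₀ →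
      ∀ y ∈ S, y ≠ p₀ → parent y = p₀ → x = y) ∧
  -- the root has a child as soon as there is a non-root node
  ((∃ p ∈ S, p ≠ p₀) → ∃ c ∈ S, c ≠ p₀ ∧ parent c = p₀) ∧
  -- every non-root node has at most two children
  (∀ q ∈ S, q ≠ p₀ → ∀ x ∈ S, ∀ y ∈ S, ∀ z ∈ S,
      x ≠ p₀ → y ≠ p₀ → z ≠ p₀ →
      parent x = q → parent y = q → parent z = q →
      x = y ∨ x = z ∨ y = z)

open scoped Classical

section WakeUpTree

variable {X : Type*}

theorem IsWakeUpTree.of_erase {d : X → X → ℝ} {p₀ : X} {S : Finset X} {parent : X → X}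
    {t : X → ℝ} (h : IsWakeUpTree d p₀ (S.erase p₀) parent t) :
    IsWakeUpTree d p₀ S parent t := by
  obtain ⟨h1, h2, h3, h4, h5⟩ := h
  simp only [Finset.mem_erase] at h2 h3 h4 h5
  refine ⟨h1, fun p hp hne => ?_, fun x hx hxne hpx y hy hyne hpy =>
    h3 x ⟨hxne, hx⟩ hxne hpx y ⟨hyne, hy⟩ hyne hpy, ?_, ?_⟩
  · obtain ⟨ha, hb⟩ := h2 p ⟨hne, hp⟩ hne
    exact ⟨ha.imp_right And.right, hb⟩
  · rintro ⟨p, hp, hne⟩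
    obtain ⟨c, hc, hc'⟩ := h4 ⟨p, ⟨hne, hp⟩, hne⟩
    exact ⟨c, hc.2, hc'⟩
  · intro q hq hqne x hx y hy z hz hxne hyne hzne
    exact h5 q ⟨hqne, hq⟩ hqne x ⟨hxne, hx⟩ y ⟨hyne, hy⟩ z ⟨hzne, hz⟩ hxne hyne hzne

theorem exists_iterate_eq_of_eqOn {f g : X → X} {c : X} {A : Finset X} (hc : c ∉ A)
    (hmem : ∀ p ∈ A, f p = c ∨ f p ∈ A) (hfg : ∀ p ∈ A, g p = f p) (n : ℕ) :
    ∀ p ∈ A, f^[n] p = c → ∃ m, g^[m] p = c := by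
  induction n with
  | zero =>
    intro p hp h
    exact absurd (h ▸ hp) hc
  | succ n ih =>
    intro p hp h
    rw [Function.iterate_succ_apply] at h
    rcases hmem p hp with h' | h'
    · exact ⟨1, by simp [hfg p hp, h']⟩
    · obtain ⟨m, hm⟩ := ih _ h' h
      exact ⟨m + 1, by rw [Function.iterate_succ_apply, hfg p hp, hm]⟩

/-- Two wake-up trees rooted at `c` are joined into a wake-up tree whose root `p₀` has `c` as its
only child. -/
theorem IsWakeUpTree.join {d : X → X → ℝ} {p₀ c : X} {A B : Finset X} {f g : X → X}
    {s t : X → ℝ} (hA : IsWakeUpTree d c A f s) (hB : IsWakeUpTree d c B g t)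
    (hcA : c ∉ A) (hcB : c ∉ B) (hAB : Disjoint A B)
    (hpA : p₀ ∉ A) (hpB : p₀ ∉ B) (hpc : p₀ ≠ c) :
    IsWakeUpTree d p₀ (insert c (A ∪ B))
      (fun x => if x ∈ A then f x else if x ∈ B then g x else p₀)
      (fun x => if x = p₀ then 0 else if x ∈ A then d p₀ c + s x
        else d p₀ c + t x) := by
  obtain ⟨s0, A2, A3, -, A5⟩ := hA
  obtain ⟨t0, B2, B3, -, B5⟩ := hB
  set F : X → X := fun x => if x ∈ A then f x else if x ∈ B then g x else p₀ with hF
  set T : X → ℝ := fun x => if x = p₀ then 0 else if x ∈ A then d p₀ c + s x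
    else d p₀ c + t x with hT
  have neA : ∀ p ∈ A, p ≠ c := fun p hp h => hcA (h ▸ hp)
  have neB : ∀ p ∈ B, p ≠ c := fun p hp h => hcB (h ▸ hp)
  have neA' : ∀ p ∈ A, p ≠ p₀ := fun p hp h => hpA (h ▸ hp)
  have neB' : ∀ p ∈ B, p ≠ p₀ := fun p hp h => hpB (h ▸ hp)
  have notA : ∀ p ∈ B, p ∉ A := fun p hp h => Finset.disjoint_left.1 hAB h hp
  have FA : ∀ p ∈ A, F p = f p := fun p hp => by simp [hF, hp]
  have FB : ∀ p ∈ B, F p = g p := fun p hp => by simp [hF, hp, notA p hp]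
  have Fc : F c = p₀ := by simp [hF, hcA, hcB]
  have Tp : T p₀ = 0 := by simp [hT]
  have Tc : T c = d p₀ c := by simp [hT, hcA, hpc.symm, t0]
  have TA : ∀ p ∈ A, T p = d p₀ c + s p := fun p hp => by simp [hT, hp, neA' p hp]
  have TB : ∀ p ∈ B, T p = d p₀ c + t p := fun p hp => by
    simp [hT, notA p hp, neB' p hp]
  have fA : ∀ p ∈ A, f p = c ∨ f p ∈ A := fun p hp => (A2 p hp (neA p hp)).1
  have gB : ∀ p ∈ B, g p = c ∨ g p ∈ B := fun p hp => (B2 p hp (neB p hp)).1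
  have root : ∀ x ∈ insert c (A ∪ B), F x = p₀ → x = c := by
    intro x hx h
    rcases Finset.mem_insert.1 hx with rfl | hx
    · rfl
    · rcases Finset.mem_union.1 hx with hx | hx
      · rw [FA x hx] at h
        rcases fA x hx with h' | h'
        · exact absurd (h.symm.trans h') hpc
        · exact absurd (h ▸ h') hpA
      · rw [FB x hx] at h
        rcases gB x hx with h' | h'
        · exact absurd (h.symm.trans h') hpc
        · exact absurd (h ▸ h') hpB
  have childA : ∀ q ∈ A, ∀ x ∈ insert c (A ∪ B), F x = q → x ∈ A ∧ f x = q := by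
    intro q hq x hx h
    rcases Finset.mem_insert.1 hx with rfl | hx
    · exact absurd (Fc.symm.trans h).symm (neA' q hq)
    · rcases Finset.mem_union.1 hx with hx | hx
      · exact ⟨hx, FA x hx ▸ h⟩
      · rw [FB x hx] at h
        rcases gB x hx with h' | h'
        · exact absurd (h.symm.trans h') (neA q hq)
        · exact absurd hq (notA q (h ▸ h'))
  have childB : ∀ q ∈ B, ∀ x ∈ insert c (A ∪ B), F x = q → x ∈ B ∧ g x = q := by
    intro q hq x hx h
    rcases Finset.mem_insert.1 hx with rfl | hx
    · exact absurd (Fc.symm.trans h).symm (neB' q hq)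
    · rcases Finset.mem_union.1 hx with hx | hx
      · rw [FA x hx] at h
        rcases fA x hx with h' | h'
        · exact absurd (h.symm.trans h') (neB q hq)
        · exact absurd (h ▸ h') (notA q hq)
      · exact ⟨hx, FB x hx ▸ h⟩
  have childc : ∀ x ∈ insert c (A ∪ B), F x = c → x ∈ A ∧ f x = c ∨ x ∈ B ∧ g x = c := by
    intro x hx h
    rcases Finset.mem_insert.1 hx with rfl | hx
    · exact absurd (Fc.symm.trans h) hpc
    · rcases Finset.mem_union.1 hx with hx | hx
      · exact Or.inl ⟨hx, FA x hx ▸ h⟩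
      · exact Or.inr ⟨hx, FB x hx ▸ h⟩
  refine ⟨Tp, ?_, ?_, fun _ => ⟨c, Finset.mem_insert_self _ _, hpc.symm, Fc⟩, ?_⟩
  · intro p hp _
    rcases Finset.mem_insert.1 hp with rfl | hp
    · exact ⟨Or.inl Fc, by rw [Fc, Tc, Tp, zero_add], 1, Fc⟩
    · rcases Finset.mem_union.1 hp with hp | hp
      · obtain ⟨_, h2, n, hn⟩ := A2 p hp (neA p hp)
        obtain ⟨m, hm⟩ := exists_iterate_eq_of_eqOn hcA fA FA n p hp hn
        refine ⟨Or.inr ?_, ?_, m + 1, by rw [Function.iterate_succ_apply', hm, Fc]⟩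
        · rw [FA p hp]
          rcases fA p hp with h | h <;> simp [h]
        · rw [FA p hp, TA p hp, h2]
          rcases fA p hp with h | h
          · rw [h, Tc, s0]; ring
          · rw [TA _ h]; ring
      · obtain ⟨_, h2, n, hn⟩ := B2 p hp (neB p hp)
        obtain ⟨m, hm⟩ := exists_iterate_eq_of_eqOn hcB gB FB n p hp hn
        refine ⟨Or.inr ?_, ?_, m + 1, by rw [Function.iterate_succ_apply', hm, Fc]⟩
        · rw [FB p hp]
          rcases gB p hp with h | h <;> simp [h]
        · rw [FB p hp, TB p hp, h2]
          rcases gB p hp with h | h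
          · rw [h, Tc, t0]; ring
          · rw [TB _ h]; ring
  · intro x hx _ h y hy _ h'
    rw [root x hx h, root y hy h']
  · intro q hq _ x hx y hy z hz _ _ _ hqx hqy hqz
    rcases Finset.mem_insert.1 hq with rfl | hq
    · have eqA : ∀ x y, x ∈ A ∧ f x = q → y ∈ A ∧ f y = q → x = y := fun x y h h' =>
        A3 x h.1 (neA x h.1) h.2 y h'.1 (neA y h'.1) h'.2
      have eqB : ∀ x y, x ∈ B ∧ g x = q → y ∈ B ∧ g y = q → x = y := fun x y h h' =>
        B3 x h.1 (neB x h.1) h.2 y h'.1 (neB y h'.1) h'.2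
      rcases childc x hx hqx with h1 | h1 <;> rcases childc y hy hqy with h2 | h2 <;>
        rcases childc z hz hqz with h3 | h3 <;>
        first
        | exact Or.inl (eqA _ _ h1 h2)
        | exact Or.inl (eqB _ _ h1 h2)
        | exact Or.inr (Or.inl (eqA _ _ h1 h3))
        | exact Or.inr (Or.inl (eqB _ _ h1 h3))
        | exact Or.inr (Or.inr (eqA _ _ h2 h3))
        | exact Or.inr (Or.inr (eqB _ _ h2 h3))
    · rcases Finset.mem_union.1 hq with hq | hq
      · obtain ⟨hx, hqx⟩ := childA q hq x hx hqx
        obtain ⟨hy, hqy⟩ := childA q hq y hy hqy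
        obtain ⟨hz, hqz⟩ := childA q hq z hz hqz
        exact A5 q hq (neA q hq) x hx y hy z hz (neA x hx) (neA y hy) (neA z hz) hqx hqy hqz
      · obtain ⟨hx, hqx⟩ := childB q hq x hx hqx
        obtain ⟨hy, hqy⟩ := childB q hq y hy hqy
        obtain ⟨hz, hqz⟩ := childB q hq z hz hqz
        exact B5 q hq (neB q hq) x hx y hy z hz (neB x hx) (neB y hy) (neB z hz) hqx hqy hqz

/-- The strip strategy: points in a strip of width `h`, swept in the direction of increasing `θ`,
where after each wake-up the two available robots take over one half of the strip each. -/
theorem exists_isWakeUpTree_strip {d : X → X → ℝ} {ρ θ : X → ℝ} {P : Set X}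
    (hd : ∀ x ∈ P, ∀ y ∈ P, d x y ≤ |ρ x - ρ y| + |θ x - θ y|) (S : Finset X) :
    ∀ (p₀ : X) (a h D : ℝ), p₀ ∈ P → p₀ ∉ S → (∀ p ∈ S, p ∈ P) →
      (∀ p ∈ S, θ p₀ ≤ θ p) → (∀ p ∈ S, a ≤ ρ p ∧ ρ p ≤ a + h) →
      (∀ p ∈ S, |ρ p₀ - ρ p| ≤ D) →
      ∃ parent t, IsWakeUpTree d p₀ S parent t ∧
        ∀ p ∈ S, t p ≤ θ p - θ p₀ + D + 2 * h := by
  induction S using Finset.strongInduction with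
  | H S ih =>
  intro p₀ a h D hp₀ hp₀S hSP hθ hρ hD
  rcases S.eq_empty_or_nonempty with rfl | hne
  · exact ⟨fun x => x, fun _ => 0, by simp [IsWakeUpTree], by simp⟩
  obtain ⟨c, hc, hmin⟩ := S.exists_min_image θ hne
  have hpc : p₀ ≠ c := fun e => hp₀S (e ▸ hc)
  set A := (S.erase c).filter (fun p => ρ p ≤ a + h / 2) with hA
  set B := (S.erase c).filter (fun p => ¬ ρ p ≤ a + h / 2) with hB
  have memA : ∀ p ∈ A, p ∈ S ∧ p ≠ c ∧ ρ p ≤ a + h / 2 := by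
    intro p hp
    simp only [hA, Finset.mem_filter, Finset.mem_erase] at hp
    exact ⟨hp.1.2, hp.1.1, hp.2⟩
  have memB : ∀ p ∈ B, p ∈ S ∧ p ≠ c ∧ a + h / 2 < ρ p := by
    intro p hp
    simp only [hB, Finset.mem_filter, Finset.mem_erase, not_le] at hp
    exact ⟨hp.1.2, hp.1.1, hp.2⟩
  have hcA : c ∉ A := fun hm => (memA c hm).2.1 rfl
  have hcB : c ∉ B := fun hm => (memB c hm).2.1 rfl
  have hSe : insert c (A ∪ B) = S := by
    rw [hA, hB, Finset.filter_union_filter_not_eq, Finset.insert_erase hc]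
  have hwidth : ∀ p ∈ S, |ρ c - ρ p| ≤ h := fun p hp =>
    abs_le.2 ⟨by linarith [hρ c hc, hρ p hp], by linarith [hρ c hc, hρ p hp]⟩
  obtain ⟨f, s, hfs, hs⟩ := ih A ((Finset.ssubset_iff_of_subset fun p hp => (memA p hp).1).2
      ⟨c, hc, hcA⟩) c a (h / 2) h (hSP c hc) hcA (fun p hp => hSP p (memA p hp).1)
    (fun p hp => hmin p (memA p hp).1)
    (fun p hp => ⟨(hρ p (memA p hp).1).1, (memA p hp).2.2⟩)
    (fun p hp => hwidth p (memA p hp).1)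
  obtain ⟨g, t, hgt, ht⟩ := ih B ((Finset.ssubset_iff_of_subset fun p hp => (memB p hp).1).2
      ⟨c, hc, hcB⟩) c (a + h / 2) (h / 2) h (hSP c hc) hcB (fun p hp => hSP p (memB p hp).1)
    (fun p hp => hmin p (memB p hp).1)
    (fun p hp => ⟨(memB p hp).2.2.le, by linarith [(hρ p (memB p hp).1).2]⟩)
    (fun p hp => hwidth p (memB p hp).1)
  have hjoin := hfs.join hgt hcA hcB (Finset.disjoint_filter_filter_not _ _ _)
    (fun hm => hp₀S (memA p₀ hm).1) (fun hm => hp₀S (memB p₀ hm).1) hpc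
  rw [hSe] at hjoin
  refine ⟨_, _, hjoin, fun p hp => ?_⟩
  have hpp : p ≠ p₀ := fun e => hp₀S (e ▸ hp)
  have hstep : d p₀ c ≤ θ c - θ p₀ + D := by
    have h1 := hd p₀ hp₀ c (hSP c hc)
    rw [abs_sub_comm (θ p₀), abs_of_nonneg (sub_nonneg.2 (hθ c hc))] at h1
    linarith [hD c hc]
  simp only [if_neg hpp]
  split_ifs with hpA
  · linarith [hs p hpA]
  · rw [← hSe, Finset.mem_insert, Finset.mem_union] at hp
    rcases hp with rfl | hp | hp
    · linarith [hgt.1, abs_nonneg (ρ p - ρ p), hwidth p hc]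
    · exact absurd hp hpA
    · linarith [ht p hp]

end WakeUpTree

theorem Complex.norm_sub_le_abs_norm_sub_add_abs_arg_sub (z : ℂ) {w : ℂ} (hw : ‖w‖ ≤ 1) :
    ‖z - w‖ ≤ |‖z‖ - ‖w‖| + |z.arg - w.arg| := by
  have key : z - w = ((‖z‖ - ‖w‖ : ℝ) : ℂ) * Complex.exp (z.arg * Complex.I) +
      ‖w‖ * (Complex.exp (w.arg * Complex.I) *
        (Complex.exp (Complex.I * ((z.arg - w.arg : ℝ) : ℂ)) - 1)) := by
    conv_lhs => rw [← Complex.norm_mul_exp_arg_mul_I z, ← Complex.norm_mul_exp_arg_mul_I w]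
    rw [mul_sub, ← Complex.exp_add]
    have : (w.arg : ℂ) * Complex.I + Complex.I * ((z.arg - w.arg : ℝ) : ℂ) =
      z.arg * Complex.I := by push_cast; ring
    rw [this]
    push_cast
    ring
  rw [key]
  refine (norm_add_le _ _).trans (add_le_add ?_ ?_)
  · rw [norm_mul, Complex.norm_exp_ofReal_mul_I, mul_one, Complex.norm_real, Real.norm_eq_abs]
  · rw [norm_mul, norm_mul, Complex.norm_exp_ofReal_mul_I, one_mul, Complex.norm_real,
      norm_norm]
    refine (mul_le_of_le_one_left (norm_nonneg _) hw).trans ?_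
    exact Real.norm_exp_I_mul_ofReal_sub_one_le

theorem exists_isometry_complex (q : EuclideanSpace ℝ (Fin 2)) :
    ∃ f : EuclideanSpace ℝ (Fin 2) → ℂ, (∀ x y, dist (f x) (f y) = dist x y) ∧
      (∀ x, ‖f x‖ = ‖x‖) ∧ f q = ‖q‖ := by
  let e := Complex.orthonormalBasisOneI.repr.symm
  have hrot : ‖Complex.exp (-(e q).arg * Complex.I)‖ = 1 := by
    exact_mod_cast Complex.norm_exp_ofReal_mul_I (-(e q).arg)
  refine ⟨fun x => e x * Complex.exp (-(e q).arg * Complex.I), fun x y => ?_, fun x => ?_, ?_⟩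
  · rw [dist_eq_norm, ← sub_mul, norm_mul, hrot, mul_one, ← dist_eq_norm, e.dist_map]
  · rw [norm_mul, hrot, mul_one, e.norm_map]
  · dsimp only
    nth_rewrite 1 [← Complex.norm_mul_exp_arg_mul_I (e q)]
    rw [mul_assoc, ← Complex.exp_add, ← add_mul, add_neg_cancel, zero_mul, Complex.exp_zero,
      mul_one, e.norm_map]

/-- The strip strategy on a set of points of the ring on which the angle `θ` from the root takes
values in `[0, π]`. -/
theorem exists_isWakeUpTree_halfRing {X : Type*} {d : X → X → ℝ} {ρ θ : X → ℝ} {P : Set X}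
    (hd : ∀ x ∈ P, ∀ y ∈ P, d x y ≤ |ρ x - ρ y| + |θ x - θ y|)
    {q : X} (hqP : q ∈ P) (hq : θ q = 0) (hr : ρ q ≤ 1) {S : Finset X} (hSP : ∀ p ∈ S, p ∈ P)
    (hρ : ∀ p ∈ S, ρ q ≤ ρ p ∧ ρ p ≤ 1) (hθ : ∀ p ∈ S, 0 ≤ θ p ∧ θ p ≤ Real.pi) :
    ∃ parent t, IsWakeUpTree d q S parent t ∧
      ∀ p ∈ S, t p ≤ Real.pi + 3 - 3 * ρ q := by
  have mem : ∀ p ∈ S.erase q, p ∈ S := fun p => Finset.mem_of_mem_erase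
  obtain ⟨f, t, hft, ht⟩ := exists_isWakeUpTree_strip hd (S.erase q) q (ρ q) (1 - ρ q) (1 - ρ q)
    hqP (Finset.notMem_erase _ _) (fun p hp => hSP p (mem p hp))
    (fun p hp => hq ▸ (hθ p (mem p hp)).1)
    (fun p hp => ⟨(hρ p (mem p hp)).1, by linarith [(hρ p (mem p hp)).2]⟩)
    (fun p hp => abs_le.2 ⟨by linarith [(hρ p (mem p hp)).2], by linarith [(hρ p (mem p hp)).1]⟩)
  refine ⟨f, t, hft.of_erase, fun p hp => ?_⟩
  by_cases hpq : p = q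
  · rw [hpq, hft.1]
    linarith [Real.pi_pos]
  · linarith [ht p (Finset.mem_erase.2 ⟨hpq, hp⟩), (hθ p hp).2]

/-- the Ring-Strategy: a finite set of points in the ring of inner radius
`r₁` and outer radius `1` can be partitioned into two sets, each admitting a wake-up tree
rooted at a given point `q` with `‖q‖ = r₁`, of makespan at most `π + 3 - 3 r₁`. -/
theorem freezeTag_ringStrategy (r₁ : ℝ) (hr₀ : 0 ≤ r₁) (hr₁ : r₁ ≤ 1)
    (q : EuclideanSpace ℝ (Fin 2)) (hq : ‖q‖ = r₁)
    (S : Finset (EuclideanSpace ℝ (Fin 2)))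
    (hS : ∀ p ∈ S, r₁ ≤ ‖p‖ ∧ ‖p‖ ≤ 1) :
    ∃ S₁ S₂ : Finset (EuclideanSpace ℝ (Fin 2)),
      S₁ ∪ S₂ = S ∧ Disjoint S₁ S₂ ∧
      (∃ (parent : EuclideanSpace ℝ (Fin 2) → EuclideanSpace ℝ (Fin 2))
         (t : EuclideanSpace ℝ (Fin 2) → ℝ),
         IsWakeUpTree dist q S₁ parent t ∧
         ∀ p ∈ S₁, t p ≤ Real.pi + 3 - 3 * r₁) ∧
      (∃ (parent : EuclideanSpace ℝ (Fin 2) → EuclideanSpace ℝ (Fin 2))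
         (t : EuclideanSpace ℝ (Fin 2) → ℝ),
         IsWakeUpTree dist q S₂ parent t ∧
         ∀ p ∈ S₂, t p ≤ Real.pi + 3 - 3 * r₁) := by
  obtain ⟨f, hdist, hnorm, hfq⟩ := exists_isometry_complex q
  have hd : ∀ x ∈ Metric.closedBall (0 : EuclideanSpace ℝ (Fin 2)) 1,
      ∀ y ∈ Metric.closedBall (0 : EuclideanSpace ℝ (Fin 2)) 1,
      dist x y ≤ |‖x‖ - ‖y‖| + |(f x).arg - (f y).arg| := by
    intro x _ y hy
    rw [mem_closedBall_zero_iff] at hy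
    rw [← hdist, dist_eq_norm, ← hnorm x, ← hnorm y]
    exact Complex.norm_sub_le_abs_norm_sub_add_abs_arg_sub _ (by rwa [hnorm])
  have hqarg : (f q).arg = 0 := by rw [hfq, Complex.arg_ofReal_of_nonneg (norm_nonneg q)]
  subst hq
  have hqP : q ∈ Metric.closedBall (0 : EuclideanSpace ℝ (Fin 2)) 1 := by
    rwa [mem_closedBall_zero_iff]
  refine ⟨S.filter (fun p => 0 ≤ (f p).arg), S.filter (fun p => ¬ 0 ≤ (f p).arg),
    Finset.filter_union_filter_not_eq _ _, Finset.disjoint_filter_filter_not _ _ _, ?_, ?_⟩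
  · refine exists_isWakeUpTree_halfRing (θ := fun x => (f x).arg) (ρ := fun x => ‖x‖)
      hd hqP hqarg hr₁
      (fun p hp => mem_closedBall_zero_iff.2 (hS p (Finset.mem_filter.1 hp).1).2)
      (fun p hp => hS p (Finset.mem_filter.1 hp).1)
      (fun p hp => ⟨(Finset.mem_filter.1 hp).2, Complex.arg_le_pi _⟩)
  · refine exists_isWakeUpTree_halfRing (θ := fun x => -(f x).arg) (ρ := fun x => ‖x‖)
      (fun x hx y hy => ?_) hqP (by simp [hqarg]) hr₁
      (fun p hp => mem_closedBall_zero_iff.2 (hS p (Finset.mem_filter.1 hp).1).2)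
      (fun p hp => hS p (Finset.mem_filter.1 hp).1)
      (fun p hp => ⟨by linarith [(Finset.mem_filter.1 hp).2], by
        linarith [Complex.neg_pi_lt_arg (f p)]⟩)
    rw [neg_sub_neg, abs_sub_comm (f y).arg]
    exact hd x hx y hy
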